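/- Let a : ℝ → ℝ be a 2π-periodic measurable function with 0 < m ≤ a(θ) ≤ M for all θ. Let w : ℝ → ℝ be 2π-periodic, locally absolutely continuous with derivative w' square-integrable on [0,2π], not almost everywhere zero, with ∫₀^{2π} a w = 0. If equality holds in the Wirtinger-type inequality, i.e. ∫₀^{2π} a w² = ((1/(2π)) ∫₀^{2π} a)² ∫₀^{2π} (1/a)(w')², then there exist C ≠ 0 and φ ∈ ℝ such that w(θ) = C·cos( (2π / ∫₀^{2π} a) · ∫₀^θ a(s) ds + φ ) for all θ. -/

import Mathlib

open MeasureTheory Real Set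

noncomputable section

/-- `w` is locally absolutely continuous with (locally integrable) derivative `w'`. -/
def IsAbsCont (w w' : ℝ → ℝ) : Prop :=
  LocallyIntegrable w' volume ∧ ∀ θ : ℝ, w θ = w 0 + ∫ s in (0:ℝ)..θ, w' s

/-- `w` is `2π`-periodic, locally absolutely continuous with derivative `w'`,
and `w'` is square-integrable on `[0, 2π]`: the `2π`-periodic class in `H¹_loc(ℝ)`. -/
def MemH1Per (w w' : ℝ → ℝ) : Prop :=
  Function.Periodic w (2 * π) ∧ IsAbsCont w w' ∧
  IntegrableOn (fun θ => w' θ ^ 2) (Ioc 0 (2 * π)) volume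

theorem AbsolutelyContinuousOnInterval.intervalIntegrable_and_integral_eq_sub
    {F G : ℝ → ℝ} {p q : ℝ} (hF : AbsolutelyContinuousOnInterval F p q)
    (hG : ∀ᵐ x, x ∈ uIcc p q → HasDerivAt F (G x) x) :
    IntervalIntegrable G volume p q ∧ ∫ x in p..q, G x = F q - F p := by
  have hae : ∀ᵐ x, x ∈ uIoc p q → deriv F x = G x := by
    filter_upwards [hG] with x hx hxm
    exact (hx (uIoc_subset_uIcc hxm)).deriv
  refine ⟨hF.intervalIntegrable_deriv.congr_ae ?_, ?_⟩
  · exact (ae_restrict_iff' measurableSet_uIoc).2 hae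
  · rw [← hF.integral_deriv_eq_sub]
    exact (intervalIntegral.integral_congr_ae hae).symm

theorem continuous_of_forall_absolutelyContinuousOnInterval {f : ℝ → ℝ}
    (hf : ∀ p q, AbsolutelyContinuousOnInterval f p q) : Continuous f := by
  refine continuous_iff_continuousAt.2 fun x => ?_
  refine (hf (x - 1) (x + 1)).continuousOn.continuousAt ?_
  rw [uIcc_of_le (by linarith)]
  exact Icc_mem_nhds (by linarith) (by linarith)

/-- An increasing Lipschitz change of the angular variable, with density `t`. -/
structure IsPhase (T t : ℝ → ℝ) : Prop where
  lipschitz : ∃ K, LipschitzWith K T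
  strictMono : StrictMono T
  ae_hasDerivAt : ∀ᵐ x, HasDerivAt T (t x) x
  density_pos : ∀ x, 0 < t x

/-- The density of the Wirtinger functional of a function `f` with derivative `d`. -/
def wirtingerDensity (t f d : ℝ → ℝ) (x : ℝ) : ℝ := d x ^ 2 / t x - t x * f x ^ 2

/-- The Picone square for the phase shifted by `s`. -/
def piconeSquare (T t f d : ℝ → ℝ) (s x : ℝ) : ℝ :=
  t x * (d x / t x - f x * (cos (T x - s) / sin (T x - s))) ^ 2

namespace IsPhase

variable {T t f d : ℝ → ℝ} {p q s : ℝ}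

theorem sub_mem_Icc (hT : IsPhase T t) (s : ℝ) {x : ℝ} (hx : x ∈ Icc p q) :
    T x - s ∈ Icc (T p - s) (T q - s) :=
  ⟨by linarith [hT.strictMono.monotone hx.1], by linarith [hT.strictMono.monotone hx.2]⟩

theorem absolutelyContinuousOnInterval_comp (hT : IsPhase T t) {h : ℝ → ℝ} (hpq : p ≤ q)
    (hh : ContDiffOn ℝ 1 h (Icc (T p - s) (T q - s))) :
    AbsolutelyContinuousOnInterval (fun x => h (T x - s)) p q := by
  obtain ⟨K, hK⟩ := hT.lipschitz
  obtain ⟨K', hK'⟩ := hh.exists_lipschitzOnWith (by decide) (convex_Icc _ _) isCompact_Icc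
  have hS : LipschitzOnWith K (fun x => T x - s) (uIcc p q) := by
    refine LipschitzOnWith.of_dist_le_mul fun x _ y _ => ?_
    simpa using hK.dist_le_mul x y
  refine LipschitzOnWith.absolutelyContinuousOnInterval
    (hK'.comp hS fun x hx => hT.sub_mem_Icc s ?_)
  rwa [uIcc_of_le hpq] at hx

theorem piconeSquare_nonneg (hT : IsPhase T t) (f d : ℝ → ℝ) (s x : ℝ) :
    0 ≤ piconeSquare T t f d s x :=
  mul_nonneg (hT.density_pos x).le (sq_nonneg _)

theorem integral_wirtingerDensity (hT : IsPhase T t) (hpq : p ≤ q)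
    (hf : AbsolutelyContinuousOnInterval f p q) (hd : ∀ᵐ x, HasDerivAt f (d x) x)
    (he : IntervalIntegrable (wirtingerDensity t f d) volume p q)
    (hs : ∀ y ∈ Icc (T p - s) (T q - s), sin y ≠ 0) :
    IntervalIntegrable (piconeSquare T t f d s) volume p q ∧
    ∫ x in p..q, wirtingerDensity t f d x = (∫ x in p..q, piconeSquare T t f d s x) +
      (f q ^ 2 * (cos (T q - s) / sin (T q - s)) - f p ^ 2 * (cos (T p - s) / sin (T p - s))) := by
  have hcot : AbsolutelyContinuousOnInterval
      (fun x => cos (T x - s) / sin (T x - s)) p q :=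
    hT.absolutelyContinuousOnInterval_comp (h := fun y => cos y / sin y) hpq
      (contDiff_cos.contDiffOn.div contDiff_sin.contDiffOn hs)
  obtain ⟨hi, hint⟩ := ((hf.fun_mul hf).fun_mul hcot).intervalIntegrable_and_integral_eq_sub
    (G := fun x => wirtingerDensity t f d x - piconeSquare T t f d s x) (by
      filter_upwards [hd, hT.ae_hasDerivAt] with x hdx hTx hx
      rw [uIcc_of_le hpq] at hx
      have hsx := hs _ (hT.sub_mem_Icc s hx)
      have hS := hTx.sub_const s
      have htx := (hT.density_pos x).ne'
      refine ((hdx.fun_mul hdx).fun_mul (hS.cos.fun_div hS.sin hsx)).congr_deriv ?_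
      simp only [wirtingerDensity, piconeSquare]
      field_simp
      ring)
  have hsq : IntervalIntegrable (piconeSquare T t f d s) volume p q :=
    (he.sub hi).congr fun x _ => by simp
  refine ⟨hsq, ?_⟩
  rw [intervalIntegral.integral_sub he hsq] at hint
  linear_combination hint

theorem sub_le_integral_wirtingerDensity (hT : IsPhase T t) (hpq : p ≤ q)
    (hf : AbsolutelyContinuousOnInterval f p q) (hd : ∀ᵐ x, HasDerivAt f (d x) x)
    (he : IntervalIntegrable (wirtingerDensity t f d) volume p q)
    (hs : ∀ y ∈ Icc (T p - s) (T q - s), sin y ≠ 0) :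
    f q ^ 2 * (cos (T q - s) / sin (T q - s)) - f p ^ 2 * (cos (T p - s) / sin (T p - s)) ≤
      ∫ x in p..q, wirtingerDensity t f d x := by
  rw [(hT.integral_wirtingerDensity hpq hf hd he hs).2]
  linarith [intervalIntegral.integral_nonneg_of_forall (μ := volume) hpq
    (hT.piconeSquare_nonneg f d s)]

theorem mul_cot_le_integral_of_left_eq_zero (hT : IsPhase T t) (hpq : p < q)
    (hf : AbsolutelyContinuousOnInterval f p q) (hd : ∀ᵐ x, HasDerivAt f (d x) x)
    (he : IntervalIntegrable (wirtingerDensity t f d) volume p q)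
    (hp : f p = 0) (hq : T q < T p + π) :
    f q ^ 2 * (cos (T q - T p) / sin (T q - T p)) ≤
      ∫ x in p..q, wirtingerDensity t f d x := by
  have hlt := hT.strictMono hpq
  have hsin : sin (T q - (T p - 0)) ≠ 0 :=
    (sin_pos_of_pos_of_lt_pi (by linarith) (by linarith)).ne'
  have hlim : ContinuousAt
      (fun δ => f q ^ 2 * (cos (T q - (T p - δ)) / sin (T q - (T p - δ)))) 0 := by
    fun_prop (disch := exact hsin)
  have hlim' := hlim.tendsto.mono_left (nhdsWithin_le_nhds (s := Ioi 0))
  simp only [sub_zero] at hlim'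
  refine le_of_tendsto hlim' ?_
  filter_upwards [Ioo_mem_nhdsGT (show (0:ℝ) < T p + π - T q by linarith)] with δ hδ
  have := hT.sub_le_integral_wirtingerDensity (s := T p - δ) hpq.le hf hd he (fun y hy =>
    (sin_pos_of_pos_of_lt_pi (by linarith [hy.1, hδ.1]) (by linarith [hy.2, hδ.2])).ne')
  simpa [hp] using this

theorem neg_mul_cot_le_integral_of_right_eq_zero (hT : IsPhase T t) (hpq : p < q)
    (hf : AbsolutelyContinuousOnInterval f p q) (hd : ∀ᵐ x, HasDerivAt f (d x) x)
    (he : IntervalIntegrable (wirtingerDensity t f d) volume p q)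
    (hq : f q = 0) (hs : s < T p) (hsq : T q = s + π) :
    -(f p ^ 2 * (cos (T p - s) / sin (T p - s))) ≤
      ∫ x in p..q, wirtingerDensity t f d x := by
  have hlt := hT.strictMono hpq
  have hsin : sin (T p - (s + 0)) ≠ 0 :=
    (sin_pos_of_pos_of_lt_pi (by linarith) (by linarith)).ne'
  have hlim : ContinuousAt
      (fun δ => -(f p ^ 2 * (cos (T p - (s + δ)) / sin (T p - (s + δ))))) 0 := by
    fun_prop (disch := exact hsin)
  have hlim' := hlim.tendsto.mono_left (nhdsWithin_le_nhds (s := Ioi 0))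
  simp only [add_zero] at hlim'
  refine le_of_tendsto hlim' ?_
  filter_upwards [Ioo_mem_nhdsGT (show (0:ℝ) < T p - s by linarith)] with δ hδ
  have := hT.sub_le_integral_wirtingerDensity (s := s + δ) hpq.le hf hd he (fun y hy =>
    (sin_pos_of_pos_of_lt_pi (by linarith [hy.1, hδ.2]) (by linarith [hy.2, hδ.1])).ne')
  simpa [hq] using this

theorem div_sin_eq_of_integral_piconeSquare_eq_zero (hT : IsPhase T t) (hpq : p ≤ q)
    (hf : AbsolutelyContinuousOnInterval f p q) (hd : ∀ᵐ x, HasDerivAt f (d x) x)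
    (hi : IntervalIntegrable (piconeSquare T t f d s) volume p q)
    (hs : ∀ y ∈ Icc (T p - s) (T q - s), sin y ≠ 0)
    (hzero : ∫ x in p..q, piconeSquare T t f d s x = 0) :
    f q / sin (T q - s) = f p / sin (T p - s) := by
  have hae : ∀ᵐ x, x ∈ uIoc p q → piconeSquare T t f d s x = 0 := by
    rw [uIoc_of_le hpq, ← ae_restrict_iff' measurableSet_Ioc]
    exact (intervalIntegral.integral_eq_zero_iff_of_le_of_nonneg_ae hpq
      (Filter.Eventually.of_forall (hT.piconeSquare_nonneg f d s)) hi).1 hzero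
  have hinv : AbsolutelyContinuousOnInterval (fun x => (sin (T x - s))⁻¹) p q :=
    hT.absolutelyContinuousOnInterval_comp (h := fun y => (sin y)⁻¹) hpq
      (contDiff_sin.contDiffOn.inv hs)
  have hfi := hf.fun_mul hinv
  have hder : ∀ᵐ x, x ∈ uIoc p q → deriv (fun x => f x * (sin (T x - s))⁻¹) x = 0 := by
    filter_upwards [hae, hd, hT.ae_hasDerivAt] with x h0 hdx hTx hx
    have hsx := hs _ (hT.sub_mem_Icc s (by simpa [uIcc_of_le hpq] using uIoc_subset_uIcc hx))
    have htx := (hT.density_pos x).ne'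
    have h1 : d x / t x - f x * (cos (T x - s) / sin (T x - s)) = 0 := by
      simpa [piconeSquare, htx] using h0 hx
    rw [(hdx.fun_mul ((hTx.sub_const s).sin.fun_inv hsx)).deriv]
    field_simp at h1 ⊢
    linear_combination h1
  have := hfi.integral_deriv_eq_sub
  rw [intervalIntegral.integral_congr_ae hder] at this
  simp only [intervalIntegral.integral_zero] at this
  simp only [div_eq_mul_inv]
  linarith

/-- The Wirtinger inequality on an arc of phase `π` whose endpoints are zeros of `f`. -/
theorem integral_wirtingerDensity_nonneg (hT : IsPhase T t)
    (hf : AbsolutelyContinuousOnInterval f p q) (hd : ∀ᵐ x, HasDerivAt f (d x) x)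
    (he : ∀ x y, IntervalIntegrable (wirtingerDensity t f d) volume x y)
    (hq : T q = T p + π) (hfp : f p = 0) (hfq : f q = 0) :
    0 ≤ ∫ x in p..q, wirtingerDensity t f d x ∧
    (∫ x in p..q, wirtingerDensity t f d x = 0 →
      ∃ C, ∀ x ∈ Icc p q, f x = C * sin (T x - T p)) := by
  have hpq : p < q := hT.strictMono.lt_iff_lt.1 (by linarith [pi_pos])
  have hac {x y : ℝ} (hx : p ≤ x) (hxy : x ≤ y) (hy : y ≤ q) :
      AbsolutelyContinuousOnInterval f x y := hf.mono (by
    rw [uIcc_of_le hxy, uIcc_of_le hpq.le]; exact Icc_subset_Icc hx hy)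
  have hsin {x y : ℝ} (hx : p < x) (hy : y < q) :
      ∀ z ∈ Icc (T x - T p) (T y - T p), sin z ≠ 0 := fun z hz =>
    (sin_pos_of_pos_of_lt_pi (by linarith [hz.1, hT.strictMono hx])
      (by linarith [hz.2, hT.strictMono hy])).ne'
  have key {x y : ℝ} (hx : p < x) (hxy : x ≤ y) (hy : y < q) :
      ∫ z in x..y, piconeSquare T t f d (T p) z ≤ ∫ z in p..q, wirtingerDensity t f d z := by
    have h1 := hT.mul_cot_le_integral_of_left_eq_zero hx (hac le_rfl hx.le (by linarith)) hd
      (he p x) hfp (by linarith [hT.strictMono (hxy.trans_lt hy)])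
    have h2 := (hT.integral_wirtingerDensity hxy (hac hx.le hxy hy.le) hd (he x y)
      (hsin hx hy)).2
    have h3 := hT.neg_mul_cot_le_integral_of_right_eq_zero hy
      (hac (by linarith) hy.le le_rfl) hd (he y q) hfq (hT.strictMono (hx.trans_le hxy)) hq
    rw [← intervalIntegral.integral_add_adjacent_intervals (he p x) (he x q),
      ← intervalIntegral.integral_add_adjacent_intervals (he x y) (he y q)]
    linarith
  obtain ⟨c, hc⟩ := exists_between hpq
  refine ⟨by simpa using key hc.1 le_rfl hc.2, fun h0 => ⟨f c / sin (T c - T p), ?_⟩⟩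
  have hconst {x y : ℝ} (hx : p < x) (hxy : x ≤ y) (hy : y < q) :
      f y / sin (T y - T p) = f x / sin (T x - T p) :=
    hT.div_sin_eq_of_integral_piconeSquare_eq_zero hxy (hac hx.le hxy hy.le) hd
      (hT.integral_wirtingerDensity hxy (hac hx.le hxy hy.le) hd (he x y) (hsin hx hy)).1
      (hsin hx hy) (le_antisymm (h0 ▸ key hx hxy hy)
        (intervalIntegral.integral_nonneg_of_forall hxy (hT.piconeSquare_nonneg f d _)))
  intro x hx
  rcases hx.1.eq_or_lt with rfl | hpx
  · simp [hfp]
  rcases hx.2.eq_or_lt with rfl | hxq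
  · simp [hfq, hq]
  have hne := hsin hpx hxq _ ⟨le_rfl, le_rfl⟩
  rw [← (div_eq_iff hne)]
  rcases le_total x c with h | h
  · exact (hconst hpx h hc.2).symm
  · exact hconst hc.1 h hxq

end IsPhase

namespace IsPhase

variable {T t w d : ℝ → ℝ} {P p q : ℝ}

theorem absolutelyContinuousOnInterval (hT : IsPhase T t) (p q : ℝ) :
    AbsolutelyContinuousOnInterval T p q := by
  obtain ⟨K, hK⟩ := hT.lipschitz
  exact hK.lipschitzOnWith.absolutelyContinuousOnInterval

theorem integral_density (hT : IsPhase T t) (p q : ℝ) :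
    IntervalIntegrable t volume p q ∧ ∫ x in p..q, t x = T q - T p :=
  (hT.absolutelyContinuousOnInterval p q).intervalIntegrable_and_integral_eq_sub
    (hT.ae_hasDerivAt.mono fun _ h _ => h)

theorem integral_density_mul_sin (hT : IsPhase T t) (hpq : p ≤ q) :
    ∫ x in p..q, t x * sin (T x - T p) = 1 - cos (T q - T p) := by
  have h := ((hT.absolutelyContinuousOnInterval_comp (h := cos) (s := T p) hpq
    contDiff_cos.contDiffOn).intervalIntegrable_and_integral_eq_sub
    (hT.ae_hasDerivAt.mono fun x hx _ => (hx.sub_const (T p)).cos)).2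
  simp only [sub_self, cos_zero, neg_mul, intervalIntegral.integral_neg] at h
  simp only [mul_comm (t _)]
  linarith

/-- On the circle, a continuous function takes the same value at some pair of antipodal points. -/
theorem exists_antipodal (hT : IsPhase T t) (hsurj : Function.Surjective T)
    (hTP : ∀ x, T (x + P) = T x + 2 * π) (hw : Function.Periodic w P) (hwc : Continuous w) :
    ∃ p r, T r = T p + π ∧ w r = w p := by
  let e := hT.strictMono.orderIsoOfSurjective T hsurj
  have he (y : ℝ) : T (e.symm y) = y := e.apply_symm_apply y
  have hper (y : ℝ) : e.symm (y + 2 * π) = e.symm y + P :=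
    hT.strictMono.injective (by rw [he, hTP, he])
  have hg : Continuous (fun y => w (e.symm (y + π)) - w (e.symm y)) := by
    have := e.symm.continuous
    fun_prop
  have hπ : w (e.symm (π + π)) = w (e.symm 0) := by
    rw [show π + π = 0 + 2 * π by ring, hper, hw]
  have hmem : (0 : ℝ) ∈ uIcc (w (e.symm (0 + π)) - w (e.symm 0))
      (w (e.symm (π + π)) - w (e.symm π)) := by
    rw [hπ, zero_add, mem_uIcc]
    rcases le_total (w (e.symm 0)) (w (e.symm π)) with h | h
    · right; constructor <;> linarith
    · left; constructor <;> linarith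
  obtain ⟨y, -, hy⟩ := intermediate_value_uIcc (a := 0) (b := π) hg.continuousOn hmem
  exact ⟨e.symm y, e.symm (y + π), by rw [he, he], sub_eq_zero.1 hy⟩

theorem intervalIntegrable_wirtingerDensity (hT : IsPhase T t) (hw : Continuous w)
    (hd : IntervalIntegrable (fun x => d x ^ 2 / t x) volume p q) :
    IntervalIntegrable (wirtingerDensity t w d) volume p q :=
  hd.sub ((hT.integral_density p q).1.mul_continuousOn (hw.pow 2).continuousOn)

theorem integral_wirtingerDensity_sub_const (hT : IsPhase T t) (hw : Continuous w)
    (hd : IntervalIntegrable (fun x => d x ^ 2 / t x) volume p q) (c : ℝ) :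
    ∫ x in p..q, wirtingerDensity t (fun x => w x - c) d x =
      (∫ x in p..q, wirtingerDensity t w d x) + 2 * c * (∫ x in p..q, t x * w x) -
        c ^ 2 * ∫ x in p..q, t x := by
  have ht := (hT.integral_density p q).1
  have htw := (ht.mul_continuousOn hw.continuousOn).const_mul (2 * c)
  have he := hT.intervalIntegrable_wirtingerDensity hw hd
  rw [← intervalIntegral.integral_const_mul, ← intervalIntegral.integral_const_mul,
    ← intervalIntegral.integral_add he htw,
    ← intervalIntegral.integral_sub (he.add htw) (ht.const_mul _)]
  refine intervalIntegral.integral_congr fun x _ => ?_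
  simp only [wirtingerDensity]
  ring

/-- The equality case of the Wirtinger inequality in a phase variable. -/
theorem exists_eq_mul_sin (hT : IsPhase T t) (hsurj : Function.Surjective T)
    (hTP : ∀ x, T (x + P) = T x + 2 * π) (ht : Function.Periodic t P)
    (hw : Function.Periodic w P) (hac : ∀ x y, AbsolutelyContinuousOnInterval w x y)
    (hd : ∀ᵐ x, HasDerivAt w (d x) x) (hdP : Function.Periodic d P)
    (hdi : ∀ x y, IntervalIntegrable (fun x => d x ^ 2 / t x) volume x y)
    (hmean : ∫ x in 0..P, t x * w x = 0)
    (hzero : ∫ x in 0..P, wirtingerDensity t w d x = 0) :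
    ∃ C s, ∀ x, w x = C * sin (T x - s) := by
  have hwc := continuous_of_forall_absolutelyContinuousOnInterval hac
  obtain ⟨p, r, hr, hrp⟩ := hT.exists_antipodal hsurj hTP hw hwc
  have hrq : T (p + P) = T r + π := by rw [hTP, hr]; ring
  have hpr : p < r := hT.strictMono.lt_iff_lt.1 (by linarith [pi_pos])
  have hrP : r < p + P := hT.strictMono.lt_iff_lt.1 (by linarith [pi_pos])
  have hmean' : ∫ x in p..p + P, t x * w x = 0 := by
    have : Function.Periodic (fun x => t x * w x) P := ht.mul hw
    rw [this.intervalIntegral_add_eq p 0, zero_add, hmean]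
  have hzero' : ∫ x in p..p + P, wirtingerDensity t w d x = 0 := by
    have : Function.Periodic (wirtingerDensity t w d) P := fun x => by
      simp only [wirtingerDensity, ht x, hw x, hdP x]
    rw [this.intervalIntegral_add_eq p 0, zero_add, hzero]
  have hacc (c x y : ℝ) : AbsolutelyContinuousOnInterval (fun x => w x - c) x y :=
    (hac x y).fun_sub contDiff_const.contDiffOn.absolutelyContinuousOnInterval
  have arc (c x y : ℝ) (hxy : T y = T x + π) (hx : w x = c) (hy : w y = c) :=
    hT.integral_wirtingerDensity_nonneg (hacc c x y) (hd.mono fun _ h => h.sub_const c)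
      (fun x y => hT.intervalIntegrable_wirtingerDensity (by fun_prop) (hdi x y)) hxy
      (sub_eq_zero.2 hx) (sub_eq_zero.2 hy)
  obtain ⟨h1, h1'⟩ := arc (w p) p r hr rfl hrp
  obtain ⟨h2, h2'⟩ := arc (w p) r (p + P) hrq hrp (hw p)
  have hsum := hT.integral_wirtingerDensity_sub_const hwc (hdi p (p + P)) (w p)
  rw [hmean', hzero', (hT.integral_density p (p + P)).2, hTP,
    ← intervalIntegral.integral_add_adjacent_intervals (b := r)
      (hT.intervalIntegrable_wirtingerDensity (by fun_prop) (hdi _ _))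
      (hT.intervalIntegrable_wirtingerDensity (by fun_prop) (hdi _ _))] at hsum
  have hsq : 0 ≤ w p ^ 2 * π := by positivity
  have hwp : w p = 0 := by
    have : w p ^ 2 * π = 0 := by linarith
    simpa [pi_ne_zero] using this
  obtain ⟨C₁, hC₁⟩ := h1' (by linarith)
  obtain ⟨C₂, hC₂⟩ := h2' (by linarith)
  simp only [hwp, sub_zero] at hC₁ hC₂
  have hint {C x y : ℝ} (hxy : T y = T x + π) (hle : x ≤ y)
      (h : ∀ z ∈ Icc x y, w z = C * sin (T z - T x)) : ∫ z in x..y, t z * w z = 2 * C := by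
    have : ∫ z in x..y, t z * w z = ∫ z in x..y, C * (t z * sin (T z - T x)) :=
      intervalIntegral.integral_congr fun z hz => by
        rw [uIcc_of_le hle] at hz
        simp only [h z hz]; ring
    rw [this, intervalIntegral.integral_const_mul, hT.integral_density_mul_sin hle, hxy]
    simp only [add_sub_cancel_left, cos_pi]
    ring
  rw [← intervalIntegral.integral_add_adjacent_intervals (b := r)
      ((hT.integral_density _ _).1.mul_continuousOn hwc.continuousOn)
      ((hT.integral_density _ _).1.mul_continuousOn hwc.continuousOn),
    hint hr hpr.le hC₁, hint hrq hrP.le hC₂] at hmean'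
  have hC : C₂ = -C₁ := by linarith
  refine ⟨C₁, T p, fun x => sub_eq_zero.1 ?_⟩
  have hper : Function.Periodic (fun x => w x - C₁ * sin (T x - T p)) P := fun x => by
    simp only [hw x, hTP, add_sub_right_comm, sin_add_two_pi]
  obtain ⟨y, hy, hxy⟩ := hper.exists_mem_Ico (by linarith) x p
  refine hxy.trans (sub_eq_zero.2 ?_)
  rcases le_total y r with h | h
  · exact hC₁ y ⟨hy.1, h⟩
  · rw [hC₂ y ⟨h, hy.2.le⟩, hC, hr, ← sub_sub, sin_sub_pi]
    ring

end IsPhase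

theorem IsAbsCont.absolutelyContinuousOnInterval {w w' : ℝ → ℝ} (h : IsAbsCont w w') (p q : ℝ) :
    AbsolutelyContinuousOnInterval w p q := by
  have hi (x y : ℝ) : IntervalIntegrable w' volume x y :=
    h.1.integrableOn_isCompact isCompact_uIcc |>.intervalIntegrable
  have hw : w = fun x => w p + ∫ s in p..x, w' s := by
    funext x
    rw [h.2 x, h.2 p, add_assoc, intervalIntegral.integral_add_adjacent_intervals (hi _ _) (hi _ _)]
  rw [hw]
  exact contDiff_const.contDiffOn.absolutelyContinuousOnInterval.fun_add
    ((hi p q).absolutelyContinuousOnInterval_intervalIntegral left_mem_uIcc)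

theorem IsAbsCont.ae_hasDerivAt {w w' : ℝ → ℝ} (h : IsAbsCont w w') :
    ∀ᵐ x, HasDerivAt w (w' x) x := by
  filter_upwards [LocallyIntegrable.ae_hasDerivAt_integral h.1] with x hx
  rw [show w = fun x => w 0 + ∫ s in 0..x, w' s from funext h.2]
  exact (hx 0).const_add _

theorem isPhase_const_mul_integral {a : ℝ → ℝ} (ha : Measurable a) {m M l : ℝ} (hm : 0 < m)
    (hbd : ∀ x, m ≤ a x ∧ a x ≤ M) (hl : 0 < l) :
    IsPhase (fun x => l * ∫ s in 0..x, a s) (fun x => l * a x) := by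
  have hnorm (x : ℝ) : ‖a x‖ ≤ M := by
    rw [norm_of_nonneg (hm.le.trans (hbd x).1)]; exact (hbd x).2
  have hloc : LocallyIntegrable a volume :=
    (locallyIntegrable_const M).mono ha.aestronglyMeasurable
      (.of_forall fun x => (hnorm x).trans (le_abs_self M))
  have hi (x y : ℝ) : IntervalIntegrable a volume x y :=
    (hloc.integrableOn_isCompact isCompact_uIcc).intervalIntegrable
  have hM : 0 ≤ M := (norm_nonneg _).trans (hnorm 0)
  refine ⟨⟨(l * M).toNNReal, LipschitzWith.of_dist_le_mul fun x y => ?_⟩, fun x y hxy => ?_,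
    ?_, fun x => mul_pos hl (hm.trans_le (hbd x).1)⟩
  · rw [dist_eq, dist_eq, ← mul_sub, intervalIntegral.integral_interval_sub_left (hi _ _) (hi _ _),
      abs_mul, abs_of_pos hl, coe_toNNReal _ (by positivity), mul_assoc]
    gcongr
    exact intervalIntegral.norm_integral_le_of_norm_le_const fun s _ => hnorm s
  · rw [mul_lt_mul_iff_right₀ hl, ← sub_pos,
      intervalIntegral.integral_interval_sub_left (hi _ _) (hi _ _)]
    exact intervalIntegral.intervalIntegral_pos_of_pos (hi _ _)
      (fun s => hm.trans_le (hbd s).1) hxy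
  · filter_upwards [LocallyIntegrable.ae_hasDerivAt_integral hloc] with x hx
    exact (hx 0).const_mul l

/-- **Equality case of the sharp Wirtinger-type inequality: equality forces
`w(θ) = C cos( (2π/∫₀^{2π}a) ∫₀^θ a + φ )`.** -/
theorem sharp_wirtinger_equality_case
    (a : ℝ → ℝ) (hameas : Measurable a) (haper : Function.Periodic a (2 * π))
    (m M : ℝ) (hm : 0 < m) (hbd : ∀ θ : ℝ, m ≤ a θ ∧ a θ ≤ M)
    (w w' : ℝ → ℝ) (hw : MemH1Per w w')
    (hw0 : ¬ (∀ᵐ θ : ℝ ∂volume, w θ = 0))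
    (hmean : ∫ θ in (0:ℝ)..(2 * π), a θ * w θ = 0)
    (heq : ∫ θ in (0:ℝ)..(2 * π), a θ * w θ ^ 2 =
      (1 / (2 * π) * ∫ θ in (0:ℝ)..(2 * π), a θ) ^ 2 *
        ∫ θ in (0:ℝ)..(2 * π), 1 / a θ * w' θ ^ 2) :
    ∃ C φ : ℝ, C ≠ 0 ∧ ∀ θ : ℝ,
      w θ = C * Real.cos (2 * π / (∫ s in (0:ℝ)..(2 * π), a s) *
        (∫ s in (0:ℝ)..θ, a s) + φ) := by
  obtain ⟨hper, hac, hsq⟩ := hw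
  have h2π : 0 < 2 * π := two_pi_pos
  have hpos (x : ℝ) : 0 < a x := hm.trans_le (hbd x).1
  have hone := isPhase_const_mul_integral hameas hm hbd one_pos
  have hi (x y : ℝ) : IntervalIntegrable a volume x y := by
    simpa using (hone.integral_density x y).1
  set L := ∫ s in (0:ℝ)..(2 * π), a s with hL
  have hLpos : 0 < L := intervalIntegral.intervalIntegral_pos_of_pos (hi _ _) hpos h2π
  set l := 2 * π / L with hl
  have hlpos : 0 < l := div_pos h2π hLpos
  have hT := isPhase_const_mul_integral hameas hm hbd hlpos
  have hsurj : Function.Surjective (fun x => l * ∫ s in 0..x, a s) := by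
    refine Continuous.surjective ?_ ?_ ?_
    · obtain ⟨K, hK⟩ := hT.lipschitz
      exact hK.continuous
    · exact (haper.tendsto_atTop_intervalIntegral_of_pos' (hi _ _) hpos h2π).const_mul_atTop hlpos
    · exact (haper.tendsto_atBot_intervalIntegral_of_pos' (hi _ _) hpos h2π).const_mul_atBot hlpos
  have hTP (x : ℝ) : l * ∫ s in 0..x + 2 * π, a s = (l * ∫ s in 0..x, a s) + 2 * π := by
    rw [← intervalIntegral.integral_add_adjacent_intervals (hi 0 x) (hi x _),
      haper.intervalIntegral_add_eq x 0, zero_add, ← hL, hl]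
    field_simp
  have hdw := hac.ae_hasDerivAt
  have hdeq : deriv w =ᵐ[volume] w' := hdw.mono fun x hx => hx.deriv
  have hdP : Function.Periodic (deriv w) (2 * π) := fun x => by
    rw [← deriv_comp_add_const, show (fun x => w (x + 2 * π)) = w from funext hper]
  have hdsq : IntervalIntegrable (fun x => deriv w x ^ 2) volume 0 (0 + 2 * π) := by
    rw [zero_add, intervalIntegrable_iff_integrableOn_Ioc_of_le h2π.le]
    exact hsq.congr (ae_restrict_of_ae (hdeq.mono fun x hx => by simp only [hx]))
  have hdi (x y : ℝ) : IntervalIntegrable (fun x => deriv w x ^ 2 / (l * a x)) volume x y := by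
    have hdsq' : IntervalIntegrable (fun x => deriv w x ^ 2) volume x y :=
      Function.Periodic.intervalIntegrable (fun x => by simp only [hdP x]) h2π.ne' hdsq x y
    refine (hdsq'.mul_const (1 / (l * m))).mono_fun
      (((measurable_deriv w).pow_const 2).div (hameas.const_mul l)).aestronglyMeasurable
      (.of_forall fun z => ?_)
    have hle : l * m ≤ l * a z := mul_le_mul_of_nonneg_left (hbd z).1 hlpos.le
    have hlm : 0 < l * m := mul_pos hlpos hm
    beta_reduce
    rw [norm_of_nonneg (by have := hpos z; positivity), norm_of_nonneg (by positivity),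
      div_eq_mul_one_div]
    gcongr
  have hwc := continuous_of_forall_absolutelyContinuousOnInterval
    hac.absolutelyContinuousOnInterval
  have hwir : ∫ x in 0..2 * π, wirtingerDensity (fun x => l * a x) w (deriv w) x = 0 := by
    have hint : ∫ x in 0..2 * π, wirtingerDensity (fun x => l * a x) w (deriv w) x =
        (∫ x in 0..2 * π, deriv w x ^ 2 / (l * a x)) - ∫ x in 0..2 * π, l * a x * w x ^ 2 :=
      intervalIntegral.integral_sub (hdi _ _)
        (((hi _ _).const_mul l).mul_continuousOn (hwc.pow 2).continuousOn)
    have h1 : ∫ x in 0..2 * π, deriv w x ^ 2 / (l * a x) =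
        l⁻¹ * ∫ x in 0..2 * π, 1 / a x * w' x ^ 2 := by
      rw [← intervalIntegral.integral_const_mul]
      refine intervalIntegral.integral_congr_ae (hdeq.mono fun x hx _ => ?_)
      rw [hx, div_eq_mul_inv, mul_inv, one_div]
      ring
    have h2 : ∫ x in 0..2 * π, l * a x * w x ^ 2 = l * ∫ x in 0..2 * π, a x * w x ^ 2 := by
      simp only [mul_assoc, intervalIntegral.integral_const_mul]
    rw [hint, h1, h2, heq, hl]
    field_simp
    ring
  obtain ⟨C, s, hC⟩ := hT.exists_eq_mul_sin hsurj hTP (fun x => by simp only [haper x]) hper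
    hac.absolutelyContinuousOnInterval (hdw.mono fun x hx => hx.deriv.symm ▸ hx) hdP hdi
    (by simp only [mul_assoc, intervalIntegral.integral_const_mul, hmean, mul_zero]) hwir
  refine ⟨C, -s - π / 2, ?_, fun θ => ?_⟩
  · rintro rfl
    exact hw0 (.of_forall fun θ => by simp [hC θ])
  · rw [hC θ, ← cos_sub_pi_div_two]
    ring_nf
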